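/- Fix integers n ≥ 1, k ≥ 1 and a real J > 0. On the Hilbert space of 2kn qubits labelled (i,r,a) with i ∈ {1,…,n}, r ∈ {1,…,k}, a ∈ {L,R}, define H^(k)_eff = (J/(2n)) ∑_{1≤i<j≤n} ∑_{α,β∈{x,y,z}} ( ∑_{r=1}^k (σ_{irL}^α σ_{jrL}^β − σ_{irR}^α σ_{jrR}^β) )². Then: (1) H^(k)_eff is positive semidefinite; and (2) for every permutation π of {1,…,k}, the state |Ω_π⟩ = ⊗_{i=1}^n ⊗_{r=1}^k |s⟩_{(i,r,L),(i,π(r),R)}, consisting of singlets pairing qubit (i,r,L) with qubit (i,π(r),R), satisfies H^(k)_eff |Ω_π⟩ = 0. Hence H^(k)_eff has at least k! ground states of energy 0. -/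

import Mathlib

open scoped BigOperators ComplexOrder

/-- The Pauli matrices `σ^x, σ^y, σ^z`, indexed by `Fin 3`. -/
noncomputable def pauli : Fin 3 → Matrix (Fin 2) (Fin 2) ℂ
  | 0 => !![0, 1; 1, 0]
  | 1 => !![0, -Complex.I; Complex.I, 0]
  | 2 => !![1, 0; 0, -1]

/-- Single-site operator acting as `M` on the qubit labelled `q = (i,r,a)` of
`(ℂ²)^{⊗2kn}` (`a = false` for `L`, `a = true` for `R`) and as the identity elsewhere. -/
noncomputable def siteOp (n k : ℕ) (q : Fin n × Fin k × Bool) (M : Matrix (Fin 2) (Fin 2) ℂ) :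
    Matrix ((Fin n × Fin k × Bool) → Fin 2) ((Fin n × Fin k × Bool) → Fin 2) ℂ :=
  Matrix.of fun x y =>
    (if ∀ p : Fin n × Fin k × Bool, p ≠ q → x p = y p then (1 : ℂ) else 0) * M (x q) (y q)

/-- The replicated effective Hamiltonian
`H^(k)_eff = (J/(2n)) ∑_{i<j} ∑_{α,β} (∑_{r=1}^k (σ_{irL}^α σ_{jrL}^β − σ_{irR}^α σ_{jrR}^β))²`. -/
noncomputable def HkEff (n k : ℕ) (J : ℝ) :
    Matrix ((Fin n × Fin k × Bool) → Fin 2) ((Fin n × Fin k × Bool) → Fin 2) ℂ :=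
  ((J / (2 * n) : ℝ) : ℂ) •
    ∑ i : Fin n, ∑ j : Fin n,
      if i < j then
        ∑ α : Fin 3, ∑ β : Fin 3,
          (∑ r : Fin k,
            (siteOp n k (i, r, false) (pauli α) * siteOp n k (j, r, false) (pauli β) -
              siteOp n k (i, r, true) (pauli α) * siteOp n k (j, r, true) (pauli β))) ^ 2
      else 0

/-- The singlet state `|s⟩ = (|01⟩ − |10⟩)/√2` of a pair of qubits. -/
noncomputable def singlet : Fin 2 × Fin 2 → ℂ := fun p =>
  ((if p = (0, 1) then (1 : ℂ) else 0) - (if p = (1, 0) then (1 : ℂ) else 0)) / (Real.sqrt 2 : ℂ)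

/-- The permuted singlet-pairing state
`|Ω_π⟩ = ⊗_{i=1}^n ⊗_{r=1}^k |s⟩_{(i,r,L),(i,π(r),R)}`, pairing qubit `(i,r,L)` with qubit
`(i,π(r),R)` into a singlet. -/
noncomputable def OmegaPerm (n k : ℕ) (π : Equiv.Perm (Fin k)) :
    ((Fin n × Fin k × Bool) → Fin 2) → ℂ := fun x =>
  ∏ i : Fin n, ∏ r : Fin k, singlet (x (i, r, false), x (i, π r, true))

lemma pauli_isHermitian (α : Fin 3) : (pauli α).IsHermitian := by
  ext a b
  fin_cases α <;> fin_cases a <;> fin_cases b <;> simp [pauli]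

/-- Acting with a Pauli matrix on one half of a singlet is minus acting with it on the other. -/
lemma pauli_singlet (α : Fin 3) (a b : Fin 2) :
    ∑ c, pauli α a c * singlet (c, b) = -∑ c, pauli α b c * singlet (a, c) := by
  fin_cases α <;> fin_cases a <;> fin_cases b <;> simp [pauli, singlet, neg_div]

section SiteOp

variable {n k : ℕ}

lemma siteOp_mulVec (q : Fin n × Fin k × Bool) (M : Matrix (Fin 2) (Fin 2) ℂ)
    (v : ((Fin n × Fin k × Bool) → Fin 2) → ℂ) (x : (Fin n × Fin k × Bool) → Fin 2) :
    (siteOp n k q M).mulVec v x = ∑ b, M (x q) b * v (Function.update x q b) := by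
  classical
  have hsum : ∑ b, M (x q) b * v (Function.update x q b) =
      ∑ y ∈ Finset.univ.image (Function.update x q), M (x q) (y q) * v y := by
    rw [Finset.sum_image fun a _ b _ h => Function.update_injective x q h]
    simp
  rw [hsum]
  rw [Matrix.mulVec, dotProduct]
  symm
  apply Finset.sum_subset_zero_on_sdiff (Finset.subset_univ _)
  · intro y hy
    have hne : ¬ ∀ p, p ≠ q → x p = y p := by
      intro h
      refine (Finset.mem_sdiff.1 hy).2 (Finset.mem_image.2 ⟨y q, Finset.mem_univ _, ?_⟩)
      funext p
      by_cases hp : p = q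
      · subst hp; simp
      · simp [hp, h p hp]
    simp only [siteOp, Matrix.of_apply, if_neg hne, zero_mul]
  · intro y hy
    obtain ⟨b, -, rfl⟩ := Finset.mem_image.1 hy
    have h : ∀ p, p ≠ q → x p = Function.update x q b p := fun p hp => by simp [hp]
    simp only [siteOp, Matrix.of_apply, if_pos h, one_mul]

lemma siteOp_commute {q q' : Fin n × Fin k × Bool} (h : q ≠ q')
    (M M' : Matrix (Fin 2) (Fin 2) ℂ) : Commute (siteOp n k q M) (siteOp n k q' M') := by
  refine Matrix.toLin'.injective (LinearMap.ext fun v => funext fun x => ?_)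
  simp only [Matrix.toLin'_apply, ← Matrix.mulVec_mulVec, siteOp_mulVec, Finset.mul_sum,
    Function.update_of_ne h, Function.update_of_ne h.symm]
  rw [Finset.sum_comm]
  refine Finset.sum_congr rfl fun b _ => Finset.sum_congr rfl fun c _ => ?_
  rw [Function.update_comm h]
  ring

lemma siteOp_isHermitian (q : Fin n × Fin k × Bool) {M : Matrix (Fin 2) (Fin 2) ℂ}
    (hM : M.IsHermitian) : (siteOp n k q M).IsHermitian := by
  ext x y
  have h : (∀ p, p ≠ q → y p = x p) ↔ ∀ p, p ≠ q → x p = y p := by simp only [eq_comm]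
  simp only [siteOp, Matrix.conjTranspose_apply, Matrix.of_apply, star_mul', hM.apply, h]
  split_ifs <;> simp

/-- Splitting off the singlet on `(i,r,L)` and `(i,π(r),R)` from `|Ω_π⟩`. -/
lemma OmegaPerm_eq_mul (π : Equiv.Perm (Fin k)) (i : Fin n) (r : Fin k)
    (x : (Fin n × Fin k × Bool) → Fin 2) :
    OmegaPerm n k π x = singlet (x (i, r, false), x (i, π r, true)) *
      ∏ p ∈ Finset.univ.erase (i, r), singlet (x (p.1, p.2, false), x (p.1, π p.2, true)) := by
  rw [Finset.mul_prod_erase Finset.univ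
    (fun p : Fin n × Fin k => singlet (x (p.1, p.2, false), x (p.1, π p.2, true)))
    (Finset.mem_univ (i, r)), Fintype.prod_prod_type]
  rfl

lemma siteOp_pauli_mulVec_OmegaPerm (π : Equiv.Perm (Fin k)) (α : Fin 3) (i : Fin n) (r : Fin k) :
    (siteOp n k (i, r, false) (pauli α)).mulVec (OmegaPerm n k π) =
      -(siteOp n k (i, π r, true) (pauli α)).mulVec (OmegaPerm n k π) := by
  funext x
  rw [Pi.neg_apply, siteOp_mulVec, siteOp_mulVec]
  set R := ∏ p ∈ Finset.univ.erase (i, r),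
    singlet (x (p.1, p.2, false), x (p.1, π p.2, true)) with hR
  have hL (b : Fin 2) : OmegaPerm n k π (Function.update x (i, r, false) b) =
      singlet (b, x (i, π r, true)) * R := by
    rw [OmegaPerm_eq_mul π i r, hR]
    congr 1
    · simp
    · refine Finset.prod_congr rfl fun p hp => ?_
      have : ¬ (p.1 = i ∧ p.2 = r) := fun h => (Finset.mem_erase.1 hp).1 (Prod.ext h.1 h.2)
      simp [this]
  have hR' (b : Fin 2) : OmegaPerm n k π (Function.update x (i, π r, true) b) =
      singlet (x (i, r, false), b) * R := by
    rw [OmegaPerm_eq_mul π i r, hR]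
    congr 1
    · simp
    · refine Finset.prod_congr rfl fun p hp => ?_
      have : ¬ (p.1 = i ∧ p.2 = r) := fun h => (Finset.mem_erase.1 hp).1 (Prod.ext h.1 h.2)
      simp [this]
  simp only [hL, hR', ← mul_assoc, ← Finset.sum_mul, pauli_singlet, neg_mul]

lemma siteOp_mul_siteOp_mulVec_OmegaPerm (π : Equiv.Perm (Fin k)) (α β : Fin 3) {i j : Fin n}
    (hij : i ≠ j) (r : Fin k) :
    (siteOp n k (i, r, false) (pauli α) * siteOp n k (j, r, false) (pauli β)).mulVec
        (OmegaPerm n k π) =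
      (siteOp n k (i, π r, true) (pauli α) * siteOp n k (j, π r, true) (pauli β)).mulVec
        (OmegaPerm n k π) := by
  have hLR : ((i, r, false) : Fin n × Fin k × Bool) ≠ (j, π r, true) := by simp
  have hRR : ((i, π r, true) : Fin n × Fin k × Bool) ≠ (j, π r, true) := by simp [hij]
  rw [← Matrix.mulVec_mulVec, siteOp_pauli_mulVec_OmegaPerm, Matrix.mulVec_neg,
    Matrix.mulVec_mulVec, (siteOp_commute hLR _ _).eq, ← Matrix.mulVec_mulVec,
    siteOp_pauli_mulVec_OmegaPerm, Matrix.mulVec_neg, neg_neg, Matrix.mulVec_mulVec,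
    (siteOp_commute hRR _ _).eq]

lemma sum_siteOp_mulVec_OmegaPerm (π : Equiv.Perm (Fin k)) (α β : Fin 3) {i j : Fin n}
    (hij : i ≠ j) :
    (∑ r : Fin k,
      (siteOp n k (i, r, false) (pauli α) * siteOp n k (j, r, false) (pauli β) -
        siteOp n k (i, r, true) (pauli α) * siteOp n k (j, r, true) (pauli β))).mulVec
      (OmegaPerm n k π) = 0 := by
  simp only [Matrix.sum_mulVec, Matrix.sub_mulVec, Finset.sum_sub_distrib,
    siteOp_mul_siteOp_mulVec_OmegaPerm π α β hij]
  rw [sub_eq_zero]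
  exact Equiv.sum_comp π fun r =>
    (siteOp n k (i, r, true) (pauli α) * siteOp n k (j, r, true) (pauli β)).mulVec
      (OmegaPerm n k π)

lemma sum_siteOp_isHermitian (α β : Fin 3) {i j : Fin n} (hij : i ≠ j) :
    (∑ r : Fin k,
      (siteOp n k (i, r, false) (pauli α) * siteOp n k (j, r, false) (pauli β) -
        siteOp n k (i, r, true) (pauli α) * siteOp n k (j, r, true) (pauli β))).IsHermitian := by
  have h (r : Fin k) (a : Bool) :
      (siteOp n k (i, r, a) (pauli α) * siteOp n k (j, r, a) (pauli β)).IsHermitian :=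
    (Matrix.IsHermitian.commute_iff (siteOp_isHermitian _ (pauli_isHermitian α))
      (siteOp_isHermitian _ (pauli_isHermitian β))).1 (siteOp_commute (by simp [hij]) _ _)
  rw [Matrix.IsHermitian, Matrix.conjTranspose_sum]
  exact Finset.sum_congr rfl fun r _ => (h r false).sub (h r true)

end SiteOp

lemma HkEff_posSemidef (n k : ℕ) {J : ℝ} (hJ : 0 ≤ J) : (HkEff n k J).PosSemidef := by
  refine Matrix.PosSemidef.smul ?_ (by exact_mod_cast (by positivity : (0 : ℝ) ≤ J / (2 * n)))
  refine Matrix.posSemidef_sum _ fun i _ => Matrix.posSemidef_sum _ fun j _ => ?_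
  split_ifs with hij
  · refine Matrix.posSemidef_sum _ fun α _ => Matrix.posSemidef_sum _ fun β _ => ?_
    have h := Matrix.posSemidef_conjTranspose_mul_self (∑ r : Fin k,
      (siteOp n k (i, r, false) (pauli α) * siteOp n k (j, r, false) (pauli β) -
        siteOp n k (i, r, true) (pauli α) * siteOp n k (j, r, true) (pauli β)))
    rwa [(sum_siteOp_isHermitian α β hij.ne).eq, ← sq] at h
  · exact Matrix.PosSemidef.zero

lemma HkEff_mulVec_OmegaPerm (n k : ℕ) (J : ℝ) (π : Equiv.Perm (Fin k)) :
    (HkEff n k J).mulVec (OmegaPerm n k π) = 0 := by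
  simp only [HkEff, Matrix.smul_mulVec, Matrix.sum_mulVec]
  refine (congrArg _ (Finset.sum_eq_zero fun i _ => Finset.sum_eq_zero fun j _ => ?_)).trans
    (smul_zero _)
  split_ifs with hij
  · simp only [Matrix.sum_mulVec, sq, ← Matrix.mulVec_mulVec,
      sum_siteOp_mulVec_OmegaPerm π _ _ hij.ne, Matrix.mulVec_zero, Finset.sum_const_zero]
  · exact Matrix.zero_mulVec _

lemma OmegaPerm_injective {n : ℕ} (hn : 1 ≤ n) (k : ℕ) :
    Function.Injective (fun π : Equiv.Perm (Fin k) => OmegaPerm n k π) := by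
  intro π π' h
  by_contra hne
  obtain ⟨r, hr⟩ : ∃ r, π r ≠ π' r := by
    by_contra! hall
    exact hne (Equiv.ext hall)
  -- the configuration whose only `0` among `L` is at `r` and only `1` among `R` is at `π r`
  let x : (Fin n × Fin k × Bool) → Fin 2 := fun p =>
    if p.2.2 then (if p.2.1 = π r then 1 else 0) else (if p.2.1 = r then 0 else 1)
  have hx : OmegaPerm n k π x ≠ 0 := by
    refine Finset.prod_ne_zero_iff.2 fun i _ => Finset.prod_ne_zero_iff.2 fun s _ => ?_
    by_cases hs : s = r <;> simp [x, hs, singlet]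
  have hx' : OmegaPerm n k π' x = 0 := by
    rw [OmegaPerm_eq_mul π' ⟨0, hn⟩ r]
    simp [x, hr.symm, singlet]
  exact hx ((congrFun h x).trans hx')

/-- the replicated effective Hamiltonian `H^(k)_eff` is positive semidefinite,
and for every permutation `π` of the `k` replicas the singlet-pairing state `|Ω_π⟩`
satisfies `H^(k)_eff |Ω_π⟩ = 0`; the map `π ↦ |Ω_π⟩` is injective, so `H^(k)_eff` has at
least `k!` ground states of energy `0`. -/
theorem HkEff_ground_states (n k : ℕ) (hn : 1 ≤ n) (hk : 1 ≤ k) (J : ℝ) (hJ : 0 < J) :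
    (HkEff n k J).PosSemidef ∧
    (∀ π : Equiv.Perm (Fin k), (HkEff n k J).mulVec (OmegaPerm n k π) = 0) ∧
    Function.Injective (fun π : Equiv.Perm (Fin k) => OmegaPerm n k π) := by
  exact ⟨HkEff_posSemidef n k hJ.le, HkEff_mulVec_OmegaPerm n k J, OmegaPerm_injective hn k⟩
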